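/- arXiv:2412.11843 — 6 statements merged into one kernel-verified Lean document; each statement's English description precedes it below -/
import Mathlib

section
/- Let G be a finite tree (a finite connected acyclic simple graph). Then the edge ideal I(G) is bridge-friendly. -/
/-- The "lcm" of a collection of supports of squarefree monomials: the union. -/
def lcmU {α : Type*} [DecidableEq α] (σ : Finset (Finset α)) : Finset α := σ.sup id

/-- `m` is a bridge of `σ`: `m ∈ σ` and removing `m` does not change the lcm. -/
def IsBridge {α : Type*} [DecidableEq α] (σ : Finset (Finset α)) (m : Finset α) : Prop :=
  m ∈ σ ∧ lcmU (σ.erase m) = lcmU σ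

/-- `m` is a gap of `σ` (relative to the generating set `M`): `m ∈ M`, `m ∉ σ`,
and adding `m` does not change the lcm. -/
def IsGap {α : Type*} [DecidableEq α] (M : Set (Finset α)) (σ : Finset (Finset α))
    (m : Finset α) : Prop :=
  m ∈ M ∧ m ∉ σ ∧ lcmU (insert m σ) = lcmU σ

/-- `m` is a true gap of `σ` w.r.t. the total order encoded by `ord`
(`a` dominates `b` iff `ord b < ord a`). -/
def IsTrueGap {α : Type*} [DecidableEq α] (M : Set (Finset α)) (ord : Finset α → ℕ)
    (σ : Finset (Finset α)) (m : Finset α) : Prop :=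
  IsGap M σ m ∧ ∀ m', IsBridge (insert m σ) m' → ord m' < ord m → IsBridge σ m'

/-- `σ` is potentially-type-2: it has a bridge dominating no true gap of `σ`. -/
def PotType2 {α : Type*} [DecidableEq α] (M : Set (Finset α)) (ord : Finset α → ℕ)
    (σ : Finset (Finset α)) : Prop :=
  ∃ m, IsBridge σ m ∧ ∀ g, IsTrueGap M ord σ g → ¬ ord g < ord m

/-- `b` is the smallest bridge of `σ` w.r.t. the total order encoded by `ord`. -/
def IsSBridge {α : Type*} [DecidableEq α] (ord : Finset α → ℕ) (σ : Finset (Finset α))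
    (b : Finset α) : Prop :=
  IsBridge σ b ∧ ∀ b', IsBridge σ b' → ord b ≤ ord b'

/-- `σ` is type-2: it is potentially-type-2, and any other potentially-type-2 `σ'` with
`σ' \ {sbridge σ'} = σ \ {sbridge σ}` satisfies `sbridge σ' ≻ sbridge σ`. -/
def Type2 {α : Type*} [DecidableEq α] (M : Set (Finset α)) (ord : Finset α → ℕ)
    (σ : Finset (Finset α)) : Prop :=
  PotType2 M ord σ ∧ ∀ σ' : Finset (Finset α), ↑σ' ⊆ M → σ' ≠ σ → PotType2 M ord σ' →
    ∀ b b', IsSBridge ord σ b → IsSBridge ord σ' b' → σ'.erase b' = σ.erase b →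
      ord b < ord b'

/-- `M` (an antichain of supports of the minimal generators of a squarefree monomial
ideal) is bridge-friendly: there is a total order on `M` (encoded by an injection
`ord : Finset α → ℕ`, where `a ≻ b` iff `ord b < ord a`) for which every
potentially-type-2 subset of `M` is type-2. -/
def BridgeFriendly {α : Type*} [DecidableEq α] (M : Set (Finset α)) : Prop :=
  ∃ ord : Finset α → ℕ, Set.InjOn ord M ∧
    ∀ σ : Finset (Finset α), ↑σ ⊆ M → PotType2 M ord σ → Type2 M ord σ

/-- The set of edges of a simple graph `G`, each edge recorded as a 2-element
`Finset` of vertices; this is the set of supports of the minimal generators of the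
edge ideal `I(G)`. -/
def edgeSets {V : Type*} [DecidableEq V] (G : SimpleGraph V) : Set (Finset V) :=
  {s | ∃ u v, G.Adj u v ∧ s = {u, v}}

theorem mem_lcmU {α : Type*} [DecidableEq α] {σ : Finset (Finset α)} {v : α} :
    v ∈ lcmU σ ↔ ∃ e ∈ σ, v ∈ e := by
  simp [lcmU, Finset.mem_sup]

theorem isBridge_iff {α : Type*} [DecidableEq α] {σ : Finset (Finset α)} {m : Finset α} :
    IsBridge σ m ↔ m ∈ σ ∧ ∀ v ∈ m, ∃ e ∈ σ, e ≠ m ∧ v ∈ e := by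
  refine and_congr_right fun hm => ?_
  simp only [Finset.ext_iff, mem_lcmU, Finset.mem_erase]
  refine ⟨fun h v hv => ?_, fun h v => ⟨by grind, ?_⟩⟩
  · obtain ⟨e, he, hve⟩ := (h v).2 ⟨m, hm, hv⟩
    exact ⟨e, he.2, he.1, hve⟩
  · rintro ⟨e, he, hve⟩
    by_cases hem : e = m
    · obtain ⟨f, hf, hfm, hvf⟩ := h v (hem ▸ hve)
      exact ⟨f, ⟨hfm, hf⟩, hvf⟩
    · exact ⟨e, ⟨hem, he⟩, hve⟩

/-- An injective ordering is a bridge-friendliness witness as soon as no generator `m` is smaller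
than both of two generators `b`, `b'` that meet `m` in incomparable sets. -/
theorem bridgeFriendly_of_ord {α : Type*} [DecidableEq α] {M : Set (Finset α)}
    (ord : Finset α → ℕ) (hinj : Set.InjOn ord M)
    (h : ∀ m ∈ M, ∀ b ∈ M, ∀ b' ∈ M, ord m < ord b → ord m < ord b' →
      ∀ v ∈ m, v ∈ b' → v ∉ b → ∀ w ∈ m, w ∈ b → w ∉ b' → False) :
    BridgeFriendly M := by
  refine ⟨ord, hinj, fun σ hσ hpot => ⟨hpot, fun σ' hσ' hne _ b b' hb hb' heq => ?_⟩⟩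
  have hbσ := hb.1.1
  have hbσ' := hb'.1.1
  have hbb' : b ≠ b' := by
    rintro rfl
    exact hne (by rw [← Finset.insert_erase hbσ', heq, Finset.insert_erase hbσ])
  have hmem : ∀ e, (e ≠ b' ∧ e ∈ σ') ↔ (e ≠ b ∧ e ∈ σ) := by
    simpa [Finset.ext_iff] using heq
  have hbnot : b' ∉ σ := fun hc => ((hmem b').2 ⟨hbb'.symm, hc⟩).1 rfl
  by_contra hle
  have hlt : ord b' < ord b :=
    lt_of_le_of_ne (not_lt.1 hle) fun he => hbb' (hinj (hσ' hbσ') (hσ hbσ) he).symm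
  have hgap : IsGap M σ b' := by
    refine ⟨hσ' hbσ', hbnot, ?_⟩
    ext v
    simp only [mem_lcmU, Finset.mem_insert]
    have := (isBridge_iff.1 hb'.1).2 v
    grind
  obtain ⟨m₀, hm₀, hm₀'⟩ := hpot
  have hnot : ¬ IsTrueGap M ord σ b' := fun ht =>
    hm₀' b' ht (hlt.trans_le (hb.2 m₀ hm₀))
  simp only [IsTrueGap, hgap, true_and, not_forall] at hnot
  obtain ⟨m, hm, hmlt, hmσ⟩ := hnot
  have hmσ' : ¬ IsBridge σ' m := fun hc => (hb'.2 m hc).not_gt hmlt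
  rw [isBridge_iff] at hm hmσ hmσ'
  have hmb' : m ≠ b' := by rintro rfl; exact hmlt.false
  have hmb : m ≠ b := by rintro rfl; exact (hmlt.trans hlt).false
  have hmin : m ∈ σ := by simpa [hmb'] using hm.1
  have hmin' : m ∈ σ' := ((hmem m).2 ⟨hmb, hmin⟩).2
  have hcover := hm.2
  simp only [hmin, hmin', true_and, not_forall] at hmσ hmσ'
  obtain ⟨v, hv, hvσ⟩ := hmσ
  obtain ⟨w, hw, hwσ⟩ := hmσ'
  obtain ⟨e, he, hem, hve⟩ := hcover v hv
  obtain ⟨f, hf, hfm, hwf⟩ := hcover w hw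
  refine h m (hσ hmin) b (hσ hbσ) b' (hσ' hbσ') (hmlt.trans hlt) hmlt
    v hv ?_ ?_ w hw ?_ ?_ <;> grind

/-- A vertex of a tree has at most one neighbour closer to the root `r`. -/
theorem SimpleGraph.IsTree.eq_of_adj_of_dist_eq {V : Type*} {G : SimpleGraph V} (hG : G.IsTree)
    {r x y z : V} (hx : G.Adj x y) (hz : G.Adj z y) (hdx : G.dist r y = G.dist r x + 1)
    (hdz : G.dist r y = G.dist r z + 1) : x = z := by
  obtain ⟨p, -, hp⟩ := hG.connected.exists_path_of_dist r x
  obtain ⟨q, -, hq⟩ := hG.connected.exists_path_of_dist r z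
  have hp' : (p.concat hx).IsPath := Walk.isPath_of_length_eq_dist _ (by simp [hp, hdx])
  have hq' : (q.concat hz).IsPath := Walk.isPath_of_length_eq_dist _ (by simp [hq, hdz])
  have := congrArg Walk.penultimate ((hG.existsUnique_path r y).unique hp' hq')
  simpa using this

/-- In a rooted tree, the middle edge of a path `w, x, y, z` is never the (weakly) deepest. -/
theorem SimpleGraph.IsTree.max_dist_lt {V : Type*} {G : SimpleGraph V} (hG : G.IsTree)
    (r : V) {w x y z : V} (hwx : G.Adj w x) (hxy : G.Adj x y) (hyz : G.Adj y z)
    (hwy : w ≠ y) (hzx : z ≠ x) :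
    max (G.dist r x) (G.dist r y) < max (G.dist r w) (G.dist r x) ∨
      max (G.dist r x) (G.dist r y) < max (G.dist r y) (G.dist r z) := by
  have h₁ := hG.dist_eq_dist_add_one_of_adj r hxy
  have h₂ := hG.dist_eq_dist_add_one_of_adj r hwx
  have h₃ := hG.dist_eq_dist_add_one_of_adj r hyz
  have h₄ : G.dist r x = G.dist r w + 1 → ¬ G.dist r x = G.dist r y + 1 :=
    fun h h' => hwy (hG.eq_of_adj_of_dist_eq hwx hxy.symm h h')
  have h₅ : G.dist r y = G.dist r z + 1 → ¬ G.dist r y = G.dist r x + 1 :=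
    fun h h' => hzx (hG.eq_of_adj_of_dist_eq hyz.symm hxy h h')
  omega

/-- On a finite type, every `ℕ`-valued function can be reversed and refined to an injection. -/
theorem exists_injective_lt_of_gt {β : Type*} [Finite β] (d : β → ℕ) :
    ∃ ord : β → ℕ, Function.Injective ord ∧ ∀ s t, d s < d t → ord t < ord s := by
  obtain ⟨n, ⟨e⟩⟩ := Finite.exists_equiv_fin β
  obtain ⟨C, hC⟩ := (Set.finite_range d).bddAbove
  have hC' : ∀ s, d s ≤ C := fun s => hC ⟨s, rfl⟩
  have hlt : ∀ s t, d s < d t → (C - d t) * n + e t < (C - d s) * n + e s := by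
    intro s t hst
    have h₁ : C - d t + 1 ≤ C - d s := by have := hC' t; omega
    have h₂ := Nat.mul_le_mul_right n h₁
    have h₃ := (e t).isLt
    rw [add_mul] at h₂
    omega
  refine ⟨fun s => (C - d s) * n + e s, fun s t hst => ?_, hlt⟩
  rcases lt_trichotomy (d s) (d t) with h | h | h
  · exact absurd hst (hlt s t h).ne'
  · exact e.injective (Fin.ext (by simpa [h] using hst))
  · exact absurd hst (hlt t s h).ne

theorem exists_adj_of_mem_edgeSets {V : Type*} [DecidableEq V] {G : SimpleGraph V} {s : Finset V}
    (hs : s ∈ edgeSets G) {x : V} (hx : x ∈ s) : ∃ y, G.Adj x y ∧ s = {x, y} := by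
  obtain ⟨u, v, huv, rfl⟩ := hs
  rcases Finset.mem_insert.1 hx with rfl | hx
  · exact ⟨v, huv, rfl⟩
  · rw [Finset.mem_singleton.1 hx]
    exact ⟨u, huv.symm, Finset.pair_comm u v⟩

/-- The edge ideal of a finite tree (a finite connected acyclic simple graph) is
bridge-friendly. -/
theorem tree_bridgeFriendly {V : Type*} [Fintype V] [DecidableEq V]
    (G : SimpleGraph V) (hG : G.IsTree) :
    BridgeFriendly (edgeSets G) := by
  obtain ⟨r⟩ := hG.connected.nonempty
  obtain ⟨ord, hinj, hord⟩ := exists_injective_lt_of_gt fun s : Finset V => s.sup (G.dist r)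
  refine bridgeFriendly_of_ord ord hinj.injOn ?_
  intro m hm b hb b' hb' hmb hmb' y hym hyb' hyb x hxm hxb hxb'
  have hyx : y ≠ x := by rintro rfl; exact hyb hxb
  obtain ⟨y', hxy, rfl⟩ := exists_adj_of_mem_edgeSets hm hxm
  obtain rfl : y = y' := by simpa [hyx] using hym
  obtain ⟨w, hxw, rfl⟩ := exists_adj_of_mem_edgeSets hb hxb
  obtain ⟨z, hyz, rfl⟩ := exists_adj_of_mem_edgeSets hb' hyb'
  have hwy : w ≠ y := by rintro rfl; simp at hyb
  have hzx : z ≠ x := by rintro rfl; simp at hxb'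
  rcases hG.max_dist_lt r hxw.symm hxy hyz hwy hzx with h | h
  · exact hmb.not_gt (hord _ _ (by simpa [max_comm] using h))
  · exact hmb'.not_gt (hord _ _ (by simpa using h))
end

section
/- Let H = (V, E) be a rooted hypertree with host tree T rooted at x, and for e ∈ E set min(e) = min{dist_T(v, x) : v ∈ e}. Suppose e_1, e_2, e_3 ∈ E and y, z ∈ V are distinct vertices with y ∈ e_1 ∩ e_3, y ∉ e_2, z ∈ e_2 ∩ e_3, and z ∉ e_1. Then min(e_3) < min(e_1) or min(e_3) < min(e_2). -/
/-- `T` is a host graph of the hypergraph with edge set `E`: for each edge `e ∈ E`, the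
induced subgraph of `T` on the vertices of `e` is connected. -/
def IsHostGraph {V : Type*} [DecidableEq V] (T : SimpleGraph V) (E : Set (Finset V)) : Prop :=
  ∀ e ∈ E, (SimpleGraph.induce (↑e : Set V) T).Connected

/-- The tree `T` together with the vertex `x` is a host tree of the hypergraph with edge
set `E` rooted at `x`: `T` is a tree host graph and the distances in `T` from `x` to the
vertices of any single edge are pairwise distinct. -/
def IsRootedHostTree {V : Type*} [DecidableEq V] (T : SimpleGraph V) (x : V)
    (E : Set (Finset V)) : Prop :=
  T.IsTree ∧ IsHostGraph T E ∧
    ∀ e ∈ E, ∀ v ∈ e, ∀ w ∈ e, v ≠ w → T.dist x v ≠ T.dist x w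

/-- In a tree, the neighbour of a vertex that is one step closer to the root is unique. -/
theorem SimpleGraph.IsTree.eq_of_adj_of_dist_add_one_eq {V : Type*} {T : SimpleGraph V}
    (hT : T.IsTree) {x z p q : V} (hp : T.Adj p z) (hq : T.Adj q z)
    (hdp : T.dist x p + 1 = T.dist x z) (hdq : T.dist x q + 1 = T.dist x z) : p = q := by
  obtain ⟨wp, hwp⟩ := hT.connected.exists_walk_length_eq_dist x p
  obtain ⟨wq, hwq⟩ := hT.connected.exists_walk_length_eq_dist x q
  have h₁ : (wp.concat hp).IsPath :=
    (wp.concat hp).isPath_of_length_eq_dist (by rw [SimpleGraph.Walk.length_concat]; omega)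
  have h₂ : (wq.concat hq).IsPath :=
    (wq.concat hq).isPath_of_length_eq_dist (by rw [SimpleGraph.Walk.length_concat]; omega)
  have h : wp.concat hp = wq.concat hq :=
    congrArg Subtype.val
      ((hT.isAcyclic.subsingleton_path x z).elim ⟨_, h₁⟩ ⟨_, h₂⟩)
  simpa using congrArg SimpleGraph.Walk.penultimate h

/-- In a set inducing a connected subgraph on which the distance from `x` is injective, every
vertex that is not closest to `x` has a neighbour in the set one step closer to `x`. -/
theorem SimpleGraph.Connected.exists_adj_dist_add_one_eq {V : Type*} {T : SimpleGraph V}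
    (hT : T.Connected) {x : V} {s : Set V} (hs : (T.induce s).Connected)
    (hinj : Set.InjOn (T.dist x) s) {z m : V} (hz : z ∈ s) (hm : m ∈ s)
    (hlt : T.dist x m < T.dist x z) :
    ∃ p ∈ s, T.Adj p z ∧ T.dist x p + 1 = T.dist x z := by
  obtain ⟨w⟩ := hs.preconnected ⟨z, hz⟩ ⟨m, hm⟩
  obtain ⟨d, -, hd₁, hd₂⟩ := w.exists_boundary_dart {v | T.dist x z ≤ T.dist x v}
    (le_refl (T.dist x z)) (not_le.mpr hlt)
  have hadj : T.Adj d.fst d.snd := d.adj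
  simp only [Set.mem_ofPred_eq, not_le] at hd₁ hd₂
  have htri : T.dist x d.fst ≤ T.dist x d.snd + T.dist (d.snd : V) d.fst := hT.dist_triangle
  rw [SimpleGraph.dist_eq_one_iff_adj.mpr hadj.symm] at htri
  have hfst : (d.fst : V) = z := hinj d.fst.2 hz (by omega)
  exact ⟨d.snd, d.snd.2, hfst ▸ hadj.symm, by omega⟩

/-- If two sets inducing connected subgraphs of a tree, on each of which the distance from `x` is
injective, share a vertex `z`, then every vertex of one that is at most as far from `x` as `z`
and at least as far as some vertex of the other belongs to the other. -/
theorem SimpleGraph.IsTree.mem_of_dist_le_of_dist_le {V : Type*} {T : SimpleGraph V}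
    (hT : T.IsTree) {x : V} {s t : Set V} (hs : (T.induce s).Connected)
    (ht : (T.induce t).Connected) (hsinj : Set.InjOn (T.dist x) s)
    (htinj : Set.InjOn (T.dist x) t) {y m : V} (hy : y ∈ t) (hm : m ∈ s)
    (hmy : T.dist x m ≤ T.dist x y) {z : V} (hzs : z ∈ s) (hzt : z ∈ t)
    (hyz : T.dist x y ≤ T.dist x z) : y ∈ s := by
  induction hn : T.dist x z - T.dist x y generalizing z with
  | zero => exact htinj hy hzt (by omega) ▸ hzs
  | succ n ih =>
    obtain ⟨p, hp, hpz, hpd⟩ :=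
      hT.connected.exists_adj_dist_add_one_eq hs hsinj hzs hm (by omega)
    obtain ⟨q, hq, hqz, hqd⟩ :=
      hT.connected.exists_adj_dist_add_one_eq ht htinj hzt hy (by omega)
    obtain rfl := hT.eq_of_adj_of_dist_add_one_eq hpz hqz hpd hqd
    exact ih hp hq (by omega) (by omega)

/-- If two edges of a rooted hypertree share a vertex `z` and the second contains a vertex closer
to the root than `z` that is not in the first, then its minimum is the smaller one. -/
theorem IsRootedHostTree.sInf_dist_lt {V : Type*} [DecidableEq V] {T : SimpleGraph V} {x : V}
    {E : Set (Finset V)} (h : IsRootedHostTree T x E) {e f : Finset V} (he : e ∈ E) (hf : f ∈ E)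
    {y z : V} (hyf : y ∈ f) (hye : y ∉ e) (hze : z ∈ e) (hzf : z ∈ f)
    (hyz : T.dist x y < T.dist x z) :
    sInf ((fun v => T.dist x v) '' ↑f) < sInf ((fun v => T.dist x v) '' ↑e) := by
  obtain ⟨hT, hhost, hdist⟩ := h
  have hinj : ∀ g ∈ E, Set.InjOn (T.dist x) (g : Set V) := fun g hg v hv w hw hvw =>
    by_contra fun hne => hdist g hg v hv w hw hne hvw
  obtain ⟨m, hm, hmin⟩ := Nat.sInf_mem (s := (fun v => T.dist x v) '' (e : Set V)) ⟨_, z, hze, rfl⟩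
  rw [← hmin]
  have hle : sInf ((fun v => T.dist x v) '' (f : Set V)) ≤ T.dist x y := Nat.sInf_le ⟨y, hyf, rfl⟩
  refine hle.trans_lt (not_le.mp fun hmy => hye ?_)
  exact hT.mem_of_dist_le_of_dist_le (hhost e he) (hhost f hf) (hinj e he) (hinj f hf) hyf hm hmy
    hze hzf hyz.le

/-- Let `E` be the edge set of a rooted hypertree with host tree `T` rooted at `x`, and
for `e ∈ E` let `min(e)` be the minimum distance in `T` from `x` to a vertex of `e`.
If `e₁, e₂, e₃ ∈ E` and `y ≠ z` are vertices with `y ∈ e₁ ∩ e₃`, `y ∉ e₂`,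
`z ∈ e₂ ∩ e₃`, `z ∉ e₁`, then `min(e₃) < min(e₁)` or `min(e₃) < min(e₂)`. -/
theorem rootedHypertree_min_lt {V : Type*} [Fintype V] [DecidableEq V]
    (E : Set (Finset V))
    (hne : ∀ e ∈ E, e.Nonempty)
    (hanti : ∀ e ∈ E, ∀ f ∈ E, e ⊆ f → e = f)
    (T : SimpleGraph V) (x : V) (hhost : IsRootedHostTree T x E)
    (e₁ e₂ e₃ : Finset V) (he₁ : e₁ ∈ E) (he₂ : e₂ ∈ E) (he₃ : e₃ ∈ E)
    (y z : V) (hyz : y ≠ z)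
    (hy₁ : y ∈ e₁) (hy₃ : y ∈ e₃) (hy₂ : y ∉ e₂)
    (hz₂ : z ∈ e₂) (hz₃ : z ∈ e₃) (hz₁ : z ∉ e₁) :
    sInf ((fun v => T.dist x v) '' ↑e₃) < sInf ((fun v => T.dist x v) '' ↑e₁) ∨
      sInf ((fun v => T.dist x v) '' ↑e₃) < sInf ((fun v => T.dist x v) '' ↑e₂) := by
  rcases lt_or_gt_of_ne (hhost.2.2 e₃ he₃ y hy₃ z hz₃ hyz) with h | h
  · exact Or.inr (hhost.sInf_dist_lt he₂ he₃ hy₃ hy₂ hz₂ hz₃ h)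
  · exact Or.inl (hhost.sInf_dist_lt he₁ he₃ hz₃ hz₁ hy₁ hy₃ h)
end

section
/- The hypergraph H on the 7-element vertex set {a, b, b', c, c', d, d'} with edge set { {a,b,b'}, {a,c,c'}, {a,d,d'}, {a,b,c}, {a,c,d}, {a,b,d} } is a hypertree but is not a rooted hypertree: H admits a host graph that is a tree, but for every host graph T of H that is a tree and every vertex x of T, some edge e of H contains two distinct vertices at equal distance from x in T. -/
namespace SimpleGraph

variable {V : Type*} {G : SimpleGraph V}

theorem exists_adj_of_connected_induce {s : Set V} (h : (G.induce s).Connected)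
    (hs : s.Nontrivial) {v : V} (hv : v ∈ s) : ∃ u ∈ s, G.Adj v u := by
  have : Nontrivial s := hs.coe_sort
  obtain ⟨u, hu⟩ := h.preconnected.exists_adj_of_nontrivial ⟨v, hv⟩
  exact ⟨u, u.2, hu⟩

theorem adj_of_connected_induce_triple {a b c : V} (hab : a ≠ b)
    (h : (G.induce {a, b, c}).Connected) : G.Adj a b ∨ G.Adj a c ∧ G.Adj c b := by
  have hs : ({a, b, c} : Set V).Nontrivial := ⟨a, by simp, b, by simp, hab⟩
  obtain ⟨u, hu, hau⟩ := exists_adj_of_connected_induce h hs (v := a) (by simp)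
  obtain ⟨w, hw, hbw⟩ := exists_adj_of_connected_induce h hs (v := b) (by simp)
  simp only [Set.mem_insert_iff, Set.mem_singleton_iff] at hu hw
  grind [G.adj_comm, G.irrefl]

/-- An acyclic graph has no cycle of length four. -/
theorem IsAcyclic.eq_of_common_neighbors (hG : G.IsAcyclic) {a b c d : V} (hab : a ≠ b)
    (hac : G.Adj a c) (hcb : G.Adj c b) (had : G.Adj a d) (hdb : G.Adj d b) : c = d := by
  let p : G.Path a b := ⟨.cons hac (.cons hcb .nil), by simp [hac.ne, hcb.ne, hab]⟩
  let q : G.Path a b := ⟨.cons had (.cons hdb .nil), by simp [had.ne, hdb.ne, hab]⟩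
  have h : p.1.support = q.1.support := by rw [(hG.subsingleton_path a b).elim p q]
  simpa [p, q] using h

theorem IsAcyclic.adj_of_connected_induce_triples (hG : G.IsAcyclic) {a b c d : V}
    (hab : a ≠ b) (hcd : c ≠ d) (hc : (G.induce {a, b, c}).Connected)
    (hd : (G.induce {a, b, d}).Connected) : G.Adj a b := by
  rcases adj_of_connected_induce_triple hab hc with h | ⟨hac, hcb⟩
  · exact h
  rcases adj_of_connected_induce_triple hab hd with h | ⟨had, hdb⟩
  · exact h
  exact absurd (hG.eq_of_common_neighbors hab hac hcb had hdb) hcd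

theorem connected_induce_starGraph {r : V} {s : Set V} (hr : r ∈ s) :
    ((starGraph r).induce s).Connected :=
  .of_isUniversal (v := ⟨r, hr⟩) fun _ hv ↦ starGraph_center_adj fun h ↦ hv (Subtype.ext h)

end SimpleGraph

/-- The hypergraph on the 7-element vertex set `{a, b, b', c, c', d, d'}` (relabelled
as `Fin 7` via `a = 0`, `b = 1`, `b' = 2`, `c = 3`, `c' = 4`, `d = 5`, `d' = 6`) with
edges `{a,b,b'}, {a,c,c'}, {a,d,d'}, {a,b,c}, {a,c,d}, {a,b,d}` is a hypertree (it has
a host graph that is a tree) but is not rooted: for every host graph `T` that is a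
tree and every vertex `x`, some edge contains two distinct vertices at equal distance
from `x` in `T`. -/
theorem hypertree_not_rooted :
    (∃ T : SimpleGraph (Fin 7), T.IsTree ∧
        IsHostGraph T ({{0, 1, 2}, {0, 3, 4}, {0, 5, 6}, {0, 1, 3}, {0, 3, 5}, {0, 1, 5}} :
          Set (Finset (Fin 7)))) ∧
      ∀ T : SimpleGraph (Fin 7), T.IsTree →
        IsHostGraph T ({{0, 1, 2}, {0, 3, 4}, {0, 5, 6}, {0, 1, 3}, {0, 3, 5}, {0, 1, 5}} :
          Set (Finset (Fin 7))) →
        ∀ x : Fin 7,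
          ∃ e ∈ ({{0, 1, 2}, {0, 3, 4}, {0, 5, 6}, {0, 1, 3}, {0, 3, 5}, {0, 1, 5}} :
            Set (Finset (Fin 7))),
            ∃ v ∈ e, ∃ w ∈ e, v ≠ w ∧ T.dist x v = T.dist x w := by
  refine ⟨⟨.starGraph 0, SimpleGraph.isTree_starGraph 0, fun e he ↦
    SimpleGraph.connected_induce_starGraph ?_⟩, fun T hT hE x ↦ ?_⟩
  · simp only [Set.mem_insert_iff, Set.mem_singleton_iff] at he
    rcases he with rfl | rfl | rfl | rfl | rfl | rfl <;> simp
  have h13 : (T.induce {0, 1, 3}).Connected := by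
    have h := hE {0, 1, 3} (by simp)
    rwa [Finset.coe_insert, Finset.coe_insert, Finset.coe_singleton] at h
  have h35 : (T.induce {0, 3, 5}).Connected := by
    have h := hE {0, 3, 5} (by simp)
    rwa [Finset.coe_insert, Finset.coe_insert, Finset.coe_singleton] at h
  have h15 : (T.induce {0, 1, 5}).Connected := by
    have h := hE {0, 1, 5} (by simp)
    rwa [Finset.coe_insert, Finset.coe_insert, Finset.coe_singleton] at h
  have h31 : (T.induce {0, 3, 1}).Connected := by rwa [Set.pair_comm]
  have h53 : (T.induce {0, 5, 3}).Connected := by rwa [Set.pair_comm]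
  have h51 : (T.induce {0, 5, 1}).Connected := by rwa [Set.pair_comm]
  have d1 := hT.dist_eq_dist_add_one_of_adj x <|
    hT.isAcyclic.adj_of_connected_induce_triples (by decide) (by decide) h13 h15
  have d3 := hT.dist_eq_dist_add_one_of_adj x <|
    hT.isAcyclic.adj_of_connected_induce_triples (by decide) (by decide) h31 h35
  have d5 := hT.dist_eq_dist_add_one_of_adj x <|
    hT.isAcyclic.adj_of_connected_induce_triples (by decide) (by decide) h51 h53
  obtain h | h | h : T.dist x 1 = T.dist x 3 ∨ T.dist x 3 = T.dist x 5 ∨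
      T.dist x 1 = T.dist x 5 := by omega
  · exact ⟨{0, 1, 3}, by simp, 1, by simp, 3, by simp, by decide, h⟩
  · exact ⟨{0, 3, 5}, by simp, 3, by simp, 5, by simp, by decide, h⟩
  · exact ⟨{0, 1, 5}, by simp, 1, by simp, 5, by simp, by decide, h⟩
end

section
/- Let M ⊆ ℕ^d be the (finite) antichain of exponent vectors of the minimal generators of a generic monomial ideal. Let p ∈ ℕ^d be such that lcm(σ) = p for some σ ⊆ M, let σ_1, ..., σ_k be the subsets of M that are minimal under inclusion among subsets with lcm equal to p, and let Σ_p = σ_1 ∪ ⋯ ∪ σ_k. Let ≻ be any total order on M such that every element of Σ_p is greater than every element of M \ Σ_p. Then for every σ ⊆ M with lcm(σ) = p for which v_L(σ) is defined, one has m_L(σ) ∉ Σ_p. -/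
/-- The lcm of a finite set of exponent vectors: the pointwise maximum. -/
def lcmV {d : ℕ} (σ : Finset (Fin d → ℕ)) : Fin d → ℕ := σ.sup id

/-- `ordI M i` is `ord_i(M)`, the minimum of the `i`-th exponents of the elements of
`M`. -/
noncomputable def ordI {d : ℕ} (M : Finset (Fin d → ℕ)) (i : Fin d) : ℕ := sInf ((fun m => m i) '' (M : Set (Fin d → ℕ)))

/-- `M` is the set of exponent vectors of the minimal generators of a generic monomial
ideal: whenever `m ≠ m'` in `M` satisfy `m i = m' i > ord_i(M)` for some `i`, there is
`m'' ∈ M` dividing `lcm(m, m')` with `max (m j) (m' j) > m'' j ↔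
max (m j) (m' j) > ord_j(M)` for every `j`. -/
def Generic {d : ℕ} (M : Finset (Fin d → ℕ)) : Prop :=
  ∀ m ∈ M, ∀ m' ∈ M, m ≠ m' → ∀ i, m i = m' i → m i > ordI M i →
    ∃ m'' ∈ M, m'' ≤ m ⊔ m' ∧
      ∀ j, (max (m j) (m' j) > m'' j ↔ max (m j) (m' j) > ordI M j)

/-- Given the total order encoded by `ord` (`a ≻ b` iff `ord b < ord a`), the initial
segment `{m ∈ σ | m ⪰ s}` of `σ` determined by `s`: if `σ = {m₁ ≻ ⋯ ≻ m_q}` and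
`s = m_k`, this is `{m₁, …, m_k}`. -/
def topSeg {d : ℕ} (ord : (Fin d → ℕ) → ℕ) (σ : Finset (Fin d → ℕ))
    (s : Fin d → ℕ) : Finset (Fin d → ℕ) :=
  σ.filter fun m => ord s ≤ ord m

/-- Writing `σ = {m₁ ≻ ⋯ ≻ m_q}`, the index `k` with `s = m_k` satisfies the defining
condition of `v_L(σ)`: there is `m ∈ M` with `m_k ≻ m` and `m ∣ lcm(m₁, …, m_k)`. -/
def GoodIdx {d : ℕ} (M : Finset (Fin d → ℕ)) (ord : (Fin d → ℕ) → ℕ)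
    (σ : Finset (Fin d → ℕ)) (s : Fin d → ℕ) : Prop :=
  s ∈ σ ∧ ∃ m ∈ M, ord m < ord s ∧ m ≤ lcmV (topSeg ord σ s)

/-- Writing `σ = {m₁ ≻ ⋯ ≻ m_q}`, `s = m_k` where `k = v_L(σ)`: `s` is the `≻`-least
element of `σ` whose index satisfies the defining condition of `v_L(σ)` (so `k` is the
largest such index). -/
def IsVL {d : ℕ} (M : Finset (Fin d → ℕ)) (ord : (Fin d → ℕ) → ℕ)
    (σ : Finset (Fin d → ℕ)) (s : Fin d → ℕ) : Prop :=
  GoodIdx M ord σ s ∧ ∀ s', GoodIdx M ord σ s' → ord s ≤ ord s'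

/-- `μ = m_L(σ)`: `v_L(σ)` is defined, say realized by `s = m_{v_L(σ)}`, and `μ` is the
`≻`-least element of `M` dividing `lcm(m₁, …, m_{v_L(σ)})`. -/
def IsML {d : ℕ} (M : Finset (Fin d → ℕ)) (ord : (Fin d → ℕ) → ℕ)
    (σ : Finset (Fin d → ℕ)) (μ : Fin d → ℕ) : Prop :=
  ∃ s, IsVL M ord σ s ∧ μ ∈ M ∧ μ ≤ lcmV (topSeg ord σ s) ∧
    ∀ μ' ∈ M, μ' ≤ lcmV (topSeg ord σ s) → ord μ ≤ ord μ'

/-- `m` is a bridge of `σ`: `m ∈ σ` and removing `m` does not change the lcm. -/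
def IsBridgeV {d : ℕ} (σ : Finset (Fin d → ℕ)) (m : Fin d → ℕ) : Prop :=
  m ∈ σ ∧ lcmV (σ.erase m) = lcmV σ

/-- `b = sbridge(σ)`, the `≻`-smallest bridge of `σ`, for the total order encoded by
`ord` (`a ≻ b` iff `ord b < ord a`). -/
def IsSBridgeV {d : ℕ} (ord : (Fin d → ℕ) → ℕ) (σ : Finset (Fin d → ℕ))
    (b : Fin d → ℕ) : Prop :=
  IsBridgeV σ b ∧ ∀ b', IsBridgeV σ b' → ord b ≤ ord b'

theorem le_lcmV {d : ℕ} {σ : Finset (Fin d → ℕ)} {m : Fin d → ℕ} (hm : m ∈ σ) : m ≤ lcmV σ :=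
  Finset.le_sup (f := id) hm

theorem lcmV_apply {d : ℕ} (σ : Finset (Fin d → ℕ)) (i : Fin d) :
    lcmV σ i = σ.sup fun m => m i :=
  Finset.sup_apply σ id i

theorem ordI_le {d : ℕ} {M : Finset (Fin d → ℕ)} {m : Fin d → ℕ} (hm : m ∈ M) (i : Fin d) :
    ordI M i ≤ m i :=
  Nat.sInf_le ⟨m, hm, rfl⟩

/-- An element of a minimal set with lcm `p` attains some coordinate of `p` alone; if that
coordinate is the least possible in `M`, the minimal set is a singleton. -/
theorem exists_apply_eq_of_minimal {d : ℕ} {M σ : Finset (Fin d → ℕ)} {p m : Fin d → ℕ}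
    (hσM : σ ⊆ M) (hσ : lcmV σ = p) (hmin : ∀ τ ⊆ σ, lcmV τ = p → τ = σ) (hm : m ∈ σ) :
    ∃ i, m i = p i ∧ (p i ≤ ordI M i → m = p) := by
  have hins : m ⊔ lcmV (σ.erase m) = p := by
    rw [← hσ]
    conv_rhs => rw [← Finset.insert_erase hm]
    exact (Finset.sup_insert (f := id)).symm
  have hne : lcmV (σ.erase m) ≠ p := fun h =>
    Finset.notMem_erase m σ (by rw [hmin _ (Finset.erase_subset m σ) h]; exact hm)
  obtain ⟨i, hi⟩ := Function.ne_iff.1 hne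
  have hmax : max (m i) (lcmV (σ.erase m) i) = p i := congrFun hins i
  refine ⟨i, by grind, fun hp => ?_⟩
  have hempty : σ.erase m = ∅ := by
    refine Finset.eq_empty_of_forall_notMem fun x hx => ?_
    have h₁ : x i ≤ lcmV (σ.erase m) i := le_lcmV hx i
    have h₂ := ordI_le (hσM (Finset.mem_of_mem_erase hx)) i
    grind
  simpa [hempty, lcmV] using hins

/-- Let `M ⊆ ℕ^d` be the antichain of exponent vectors of the minimal generators of a
generic monomial ideal, `p` the lcm of some subset of `M`, `Sp = Σ_p` the union of the
subsets of `M` that are minimal among those with lcm `p`, and `≻` a total order on `M`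
(encoded by `ord`, with `a ≻ b` iff `ord b < ord a`) for which every element of `Σ_p`
dominates every element of `M \ Σ_p`.  Then for every `σ ⊆ M` with `lcm(σ) = p` for
which `v_L(σ)` is defined, `m_L(σ) ∉ Σ_p`. -/
theorem generic_mL_not_mem {d : ℕ} (M : Finset (Fin d → ℕ))
    (hanti : ∀ m ∈ M, ∀ m' ∈ M, m ≤ m' → m = m')
    (hgen : Generic M)
    (p : Fin d → ℕ) (hp : ∃ σ ⊆ M, lcmV σ = p)
    (Sp : Set (Fin d → ℕ))
    (hSp : Sp = {m | ∃ σ : Finset (Fin d → ℕ), σ ⊆ M ∧ lcmV σ = p ∧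
      (∀ τ ⊆ σ, lcmV τ = p → τ = σ) ∧ m ∈ σ})
    (ord : (Fin d → ℕ) → ℕ) (hinj : Set.InjOn ord ↑M)
    (hord : ∀ m ∈ M, ∀ m' ∈ M, m ∈ Sp → m' ∉ Sp → ord m' < ord m) :
    ∀ σ ⊆ M, lcmV σ = p → ∀ μ, IsML M ord σ μ → μ ∉ Sp := by
  rintro σ hσM hσp μ ⟨s, ⟨⟨hs, m, hmM, hms, hmle⟩, -⟩, hμM, hμle, hμmin⟩ hμS
  have hseg : ∀ t ∈ topSeg ord σ s, t ∈ M ∧ μ ≠ t := fun t ht => by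
    obtain ⟨htσ, hst⟩ := Finset.mem_filter.1 ht
    refine ⟨hσM htσ, ?_⟩
    rintro rfl
    exact absurd (hμmin m hmM hmle) (by omega)
  have hqp : lcmV (topSeg ord σ s) ≤ p := hσp ▸ Finset.sup_mono (Finset.filter_subset _ _)
  have hdvd : ∀ x ∈ M, x ≤ lcmV (topSeg ord σ s) → x ∈ Sp := fun x hx hxle => by
    by_contra hxS
    exact absurd (hord μ hμM x hx hμS hxS) (not_lt.2 (hμmin x hx hxle))
  have hcoord : ∀ x ∈ Sp, ∃ i, x i = p i ∧ (p i ≤ ordI M i → x = p) := by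
    rw [hSp]
    rintro x ⟨τ, hτM, hτ, hmin, hx⟩
    exact exists_apply_eq_of_minimal hτM hτ hmin hx
  obtain ⟨i, hi, hi'⟩ := hcoord μ hμS
  obtain ⟨t, ht, hti⟩ : ∃ t ∈ topSeg ord σ s, lcmV (topSeg ord σ s) i = t i := by
    simp only [lcmV_apply]
    refine Finset.exists_mem_eq_sup _ ⟨s, ?_⟩ _
    exact Finset.mem_filter.2 ⟨hs, le_rfl⟩
  obtain ⟨htM, hμt⟩ := hseg t ht
  have htq := le_lcmV ht
  have hμti : μ i = t i := by
    have h₁ : μ i ≤ lcmV (topSeg ord σ s) i := hμle i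
    have h₂ : lcmV (topSeg ord σ s) i ≤ p i := hqp i
    omega
  have hi_gt : ordI M i < μ i := by
    by_contra h
    have hμp := hi' (by omega)
    exact hμt (hanti t htM μ hμM (hμp ▸ htq.trans hqp)).symm
  obtain ⟨x, hxM, hxle, hx⟩ := hgen μ hμM t htM hμt i hμti hi_gt
  have hlcm := sup_le hμle htq
  obtain ⟨j, hj, hj'⟩ := hcoord x (hdvd x hxM (hxle.trans hlcm))
  have hle : max (μ j) (t j) ≤ p j := (hlcm.trans hqp) j
  have hge : x j ≤ max (μ j) (t j) := hxle j
  have hxp := hj' (by have := hx j; omega)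
  have hμx := hanti μ hμM x hxM (hxp ▸ hμle.trans hqp)
  have htx := hanti t htM x hxM (hxp ▸ htq.trans hqp)
  exact hμt (hμx.trans htx.symm)
end

section
/- Let M ⊆ ℕ^d be the (finite) antichain of exponent vectors of the minimal generators of a generic monomial ideal. Let p ∈ ℕ^d be such that lcm(σ) = p for some σ ⊆ M, let σ_1, ..., σ_k be the subsets of M that are minimal under inclusion among subsets with lcm equal to p, and let Σ_p = σ_1 ∪ ⋯ ∪ σ_k. Let ≻ be any total order on M such that every element of Σ_p is greater than every element of M \ Σ_p. Then for every σ ⊆ M with lcm(σ) = p such that v_L(σ) is defined and m_L(σ) ∈ σ, one has sbridge(σ) = m_L(σ). -/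
theorem lcmV_mono {d : ℕ} {σ τ : Finset (Fin d → ℕ)} (h : σ ⊆ τ) : lcmV σ ≤ lcmV τ :=
  Finset.sup_mono h

theorem lcmV_eq_sup_erase {d : ℕ} {σ : Finset (Fin d → ℕ)} {m : Fin d → ℕ} (hm : m ∈ σ) :
    lcmV σ = m ⊔ lcmV (σ.erase m) := by
  conv_lhs => rw [← Finset.insert_erase hm]
  simp [lcmV]

/-- A positive coordinate of the lcm is attained. -/
theorem exists_mem_apply_eq_lcmV {d : ℕ} {σ : Finset (Fin d → ℕ)} {i : Fin d}
    (h : 0 < lcmV σ i) : ∃ m ∈ σ, m i = lcmV σ i := by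
  have hne : σ.Nonempty := by
    rw [Finset.nonempty_iff_ne_empty]
    rintro rfl
    simp [lcmV] at h
  obtain ⟨m, hm, he⟩ := Finset.exists_mem_eq_sup σ hne (fun m => m i)
  exact ⟨m, hm, by simp [lcmV, Finset.sup_apply, he]⟩

/-- An element of a minimal set with lcm `p` is `p` itself, or attains `p` at a coordinate
where `p` exceeds the minimal exponent. -/
theorem eq_or_exists_apply_eq_of_mem_minimal {d : ℕ} {M τ : Finset (Fin d → ℕ)}
    {m : Fin d → ℕ} (hτM : τ ⊆ M) (hmin : ∀ ρ ⊆ τ, lcmV ρ = lcmV τ → ρ = τ) (hm : m ∈ τ) :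
    m = lcmV τ ∨ ∃ k, m k = lcmV τ k ∧ ordI M k < lcmV τ k := by
  rcases (τ.erase m).eq_empty_or_nonempty with he | ⟨t, ht⟩
  · left
    rw [lcmV_eq_sup_erase hm, he]
    exact (sup_bot_eq m).symm
  · right
    have hlt : ∃ k, lcmV (τ.erase m) k < lcmV τ k := by
      by_contra! hle
      have := hmin _ (Finset.erase_subset m τ)
        (le_antisymm (lcmV_mono (Finset.erase_subset m τ)) hle)
      exact Finset.notMem_erase m τ (this.symm ▸ hm)
    obtain ⟨k, hk⟩ := hlt
    refine ⟨k, ?_, ?_⟩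
    · have h := congrFun (lcmV_eq_sup_erase hm) k
      rw [Pi.sup_apply] at h
      omega
    · exact ((ordI_le (hτM (Finset.mem_of_mem_erase ht)) k).trans (le_lcmV ht k)).trans_lt hk

theorem exists_minimal_subset_lcmV {d : ℕ} (σ : Finset (Fin d → ℕ)) :
    ∃ τ ⊆ σ, lcmV τ = lcmV σ ∧ ∀ ρ ⊆ τ, lcmV ρ = lcmV σ → ρ = τ := by
  obtain ⟨τ, hτσ, hτ⟩ := exists_minimal_le_of_wellFoundedLT
    (fun τ : Finset (Fin d → ℕ) => lcmV τ = lcmV σ) σ rfl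
  exact ⟨τ, hτσ, hτ.prop, fun ρ hρ h => hτ.eq_of_le h hρ⟩

/-- If the `≻`-least element `a` of `σ` is a bridge, then `σ` contains nothing
strictly between `a` and `m_{v_L(σ)}`. -/
theorem IsVL.le_ord_of_isBridgeV {d : ℕ} {M σ : Finset (Fin d → ℕ)} {ord : (Fin d → ℕ) → ℕ}
    {s a m : Fin d → ℕ} (hs : IsVL M ord σ s) (hσM : σ ⊆ M) (hinj : Set.InjOn ord ↑M)
    (hleast : ∀ x ∈ σ, ord a ≤ ord x) (ha : IsBridgeV σ a) (hm : m ∈ σ)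
    (ham : ord a < ord m) : ord s ≤ ord m := by
  have hm' : m ∈ σ.erase a := Finset.mem_erase.2 ⟨by rintro rfl; exact ham.false, hm⟩
  obtain ⟨t, ht, htmin⟩ := Finset.exists_min_image (σ.erase a) ord ⟨m, hm'⟩
  obtain ⟨hta, htσ⟩ := Finset.mem_erase.1 ht
  have hat : ord a < ord t := (hleast t htσ).lt_of_ne fun h =>
    hta (hinj (hσM ha.1) (hσM htσ) h).symm
  have hsub : σ.erase a ⊆ topSeg ord σ t := fun x hx =>
    Finset.mem_filter.2 ⟨Finset.mem_of_mem_erase hx, htmin x hx⟩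
  refine (hs.2 t ⟨htσ, a, hσM ha.1, hat, ?_⟩).trans (htmin m hm')
  exact (le_lcmV ha.1).trans (ha.2.symm.le.trans (lcmV_mono hsub))

/-- Let `M ⊆ ℕ^d` be the antichain of exponent vectors of the minimal generators of a
generic monomial ideal, `p` the lcm of some subset of `M`, `Sp = Σ_p` the union of the
subsets of `M` that are minimal among those with lcm `p`, and `≻` a total order on `M`
(encoded by `ord`, with `a ≻ b` iff `ord b < ord a`) for which every element of `Σ_p`
dominates every element of `M \ Σ_p`.  Then for every `σ ⊆ M` with `lcm(σ) = p` such
that `v_L(σ)` is defined and `m_L(σ) ∈ σ`, one has `sbridge(σ) = m_L(σ)`. -/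
theorem generic_sbridge_eq_mL {d : ℕ} (M : Finset (Fin d → ℕ))
    (hanti : ∀ m ∈ M, ∀ m' ∈ M, m ≤ m' → m = m')
    (hgen : Generic M)
    (p : Fin d → ℕ) (hp : ∃ σ ⊆ M, lcmV σ = p)
    (Sp : Set (Fin d → ℕ))
    (hSp : Sp = {m | ∃ σ : Finset (Fin d → ℕ), σ ⊆ M ∧ lcmV σ = p ∧
      (∀ τ ⊆ σ, lcmV τ = p → τ = σ) ∧ m ∈ σ})
    (ord : (Fin d → ℕ) → ℕ) (hinj : Set.InjOn ord ↑M)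
    (hord : ∀ m ∈ M, ∀ m' ∈ M, m ∈ Sp → m' ∉ Sp → ord m' < ord m) :
    ∀ σ ⊆ M, lcmV σ = p → ∀ μ, IsML M ord σ μ → μ ∈ σ → IsSBridgeV ord σ μ := by
  subst hSp
  rintro σ hσM rfl μ ⟨s, hs, hμM, hμs, hμmin⟩ hμσ
  have hμs_lt : ord μ < ord s := by
    obtain ⟨-, m, hmM, hms, hm⟩ := hs.1
    exact (hμmin m hmM hm).trans_lt hms
  have hsub : topSeg ord σ s ⊆ σ.erase μ := fun x hx => by
    obtain ⟨hxσ, hx⟩ := Finset.mem_filter.1 hx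
    exact Finset.mem_erase.2 ⟨by rintro rfl; omega, hxσ⟩
  refine ⟨⟨hμσ, ?_⟩, ?_⟩
  · rw [lcmV_eq_sup_erase hμσ]
    exact (sup_eq_right.2 (hμs.trans (lcmV_mono hsub))).symm
  intro b hb
  by_contra! hbμ
  obtain ⟨a, haσ, hamin⟩ := Finset.exists_min_image σ ord ⟨μ, hμσ⟩
  have haμ : ord a < ord μ := (hamin b hb.1).trans_lt hbμ
  have ha_least : ∀ m ∈ M, m ≤ lcmV σ → ord a ≤ ord m := by
    intro m hmM hm
    by_contra! hma
    have htop : σ ⊆ topSeg ord σ a := fun x hx => Finset.mem_filter.2 ⟨hx, hamin x hx⟩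
    have := hs.2 a ⟨haσ, m, hmM, hma, hm.trans (lcmV_mono htop)⟩
    omega
  -- It suffices to find one divisor of the lcm outside `Σ_p`.
  have key : ∀ m ∈ M, m ≤ lcmV σ → ∃ τ : Finset (Fin d → ℕ), τ ⊆ M ∧ lcmV τ = lcmV σ ∧
      (∀ ρ ⊆ τ, lcmV ρ = lcmV σ → ρ = τ) ∧ m ∈ τ := by
    intro m hmM hm
    by_contra hmS
    obtain ⟨τ, hτσ, hτ, hτmin⟩ := exists_minimal_subset_lcmV σ
    have haτ : a ∉ τ := fun haτ =>
      (ha_least m hmM hm).not_gt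
        (hord a (hσM haσ) m hmM ⟨τ, hτσ.trans hσM, hτ, hτmin, haτ⟩ hmS)
    have hbr : IsBridgeV σ a := ⟨haσ, le_antisymm (lcmV_mono (Finset.erase_subset a σ))
      (hτ.symm.le.trans (lcmV_mono (Finset.subset_erase.2 ⟨hτσ, haτ⟩)))⟩
    exact (hs.le_ord_of_isBridgeV hσM hinj hamin hbr hμσ haμ).not_gt hμs_lt
  have dichotomy : ∀ m ∈ M, m ≤ lcmV σ →
      m = lcmV σ ∨ ∃ k, m k = lcmV σ k ∧ ordI M k < lcmV σ k := by
    intro m hmM hm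
    obtain ⟨τ, hτM, hτ, hτmin, hmτ⟩ := key m hmM hm
    rw [← hτ] at hτmin ⊢
    exact eq_or_exists_apply_eq_of_mem_minimal hτM hτmin hmτ
  have hbM := hσM hb.1
  rcases dichotomy b hbM (le_lcmV hb.1) with hbp | ⟨j, hbj, hj⟩
  · have := hanti μ hμM b hbM (hbp ▸ le_lcmV hμσ)
    exact hbμ.ne (by rw [this])
  · obtain ⟨c, hc, hcj⟩ : ∃ c ∈ σ.erase b, c j = lcmV (σ.erase b) j :=
      exists_mem_apply_eq_lcmV (by rw [hb.2]; omega)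
    rw [hb.2] at hcj
    obtain ⟨hcb, hcσ⟩ := Finset.mem_erase.1 hc
    obtain ⟨m, hmM, hmle, hm⟩ := hgen b hbM c (hσM hcσ) hcb.symm j (hbj.trans hcj.symm)
      (by omega)
    have hbc : b ⊔ c ≤ lcmV σ := sup_le (le_lcmV hb.1) (le_lcmV hcσ)
    have hmj : m j < lcmV σ j := by
      have := (hm j).2 (by rw [hbj, hcj]; simpa using hj)
      rwa [hbj, hcj, max_self] at this
    rcases dichotomy m hmM (hmle.trans hbc) with hmp | ⟨k, hmk, hk⟩
    · exact hmj.ne (congrFun hmp j)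
    · have h1 := hmle k
      have h2 := hbc k
      have h3 := hm k
      rw [Pi.sup_apply] at h1 h2
      have := h3.2 (hk.trans_le (hmk ▸ h1))
      exact (this.trans_le h2).ne hmk
end

section
/- Let M ⊆ ℕ^d be the (finite) antichain of exponent vectors of the minimal generators of a monomial ideal with linear quotients, witnessed by a total order ⊐ on M. Fix m ∈ M, let J_m = {j : there exists n ∈ M with m ⊐ n and lcm(n, m) = m + e_j}, for each j ∈ J_m fix a choice n_j ∈ M with m ⊐ n_j and lcm(n_j, m) = m + e_j, and set N_m = {n_j : j ∈ J_m}. Let ≻ be any total order on M such that: every element of M \ N_m is greater than every element of N_m; for j, j' ∈ J_m, n_j ≻ n_{j'} if and only if j > j'; and ≻ agrees with ⊐ on M \ N_m. Then for every σ ⊆ M with m ∈ σ, m the ⊐-maximum of σ, and σ ∩ (M \ (N_m ∪ {m})) ≠ ∅, the element v_L(σ) is defined and m_L(σ) ∈ N_m. -/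
/-- Setting of [BW02, Proposition 4.3]: `M ⊆ ℕ^d` is the antichain of exponent vectors
of the minimal generators of a monomial ideal with linear quotients, witnessed by the
total order `⊐` encoded by the injection `q` (`a ⊐ b` iff `q b < q a`).  For a fixed
`m ∈ M`: `J = J_m` consists of the indices `j` such that `lcm(n, m) = m + e_j` for some
`n ∈ M` with `m ⊐ n`; for `j ∈ J_m` the element `nn j = n_j^m ∈ M` is a fixed choice
with `m ⊐ n_j^m` and `lcm(n_j^m, m) = m + e_j`; and `Nm = N_m = {n_j^m : j ∈ J_m}`.
The total order `≻` on `M` is encoded by the injection `ord` (`a ≻ b` iff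
`ord b < ord a`): every element of `M \ N_m` dominates every element of `N_m`; on
`N_m`, `n_j^m ≻ n_{j'}^m` iff `j > j'`; and on `M \ N_m`, `≻` agrees with `⊐`. -/
theorem linearQuotients_mL_mem {d : ℕ} (M : Finset (Fin d → ℕ))
    (hanti : ∀ m ∈ M, ∀ m' ∈ M, m ≤ m' → m = m')
    (q : (Fin d → ℕ) → ℕ) (hqinj : Set.InjOn q ↑M)
    (hLQ : ∀ m ∈ M, ∀ m' ∈ M, q m' < q m →
      ∃ m'' ∈ M, ∃ g : Fin d, q m'' < q m ∧ m ⊔ m'' = m + Pi.single g 1 ∧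
        m + Pi.single g 1 ≤ m ⊔ m')
    (m : Fin d → ℕ) (hm : m ∈ M)
    (J : Finset (Fin d))
    (hJ : ∀ j : Fin d, j ∈ J ↔ ∃ n ∈ M, q n < q m ∧ m ⊔ n = m + Pi.single j 1)
    (nn : Fin d → (Fin d → ℕ))
    (hnn : ∀ j ∈ J, nn j ∈ M ∧ q (nn j) < q m ∧ m ⊔ nn j = m + Pi.single j 1)
    (Nm : Finset (Fin d → ℕ)) (hNm : Nm = J.image nn)
    (ord : (Fin d → ℕ) → ℕ) (hordinj : Set.InjOn ord ↑M)
    (hord₁ : ∀ a ∈ M, a ∉ Nm → ∀ b ∈ Nm, ord b < ord a)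
    (hord₂ : ∀ j ∈ J, ∀ j' ∈ J, (ord (nn j') < ord (nn j) ↔ j' < j))
    (hord₃ : ∀ a ∈ M, ∀ b ∈ M, a ∉ Nm → b ∉ Nm → (ord b < ord a ↔ q b < q a)) :
    ∀ σ ⊆ M, m ∈ σ → (∀ s ∈ σ, q s ≤ q m) →
      (∃ s ∈ σ, s ∉ Nm ∧ s ≠ m) →
      (∃ s, IsVL M ord σ s) ∧ ∀ μ, IsML M ord σ μ → μ ∈ Nm := by
  intro σ hσM hmσ hmax ⟨s, hsσ, hsN, hsm⟩
  have hmN : m ∉ Nm := by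
    rw [hNm, Finset.mem_image]
    rintro ⟨j, hj, hjm⟩
    have hlt := (hnn j hj).2.1
    rw [hjm] at hlt
    exact lt_irrefl _ hlt
  have hqs : q s < q m :=
    lt_of_le_of_ne (hmax s hsσ) fun h => hsm (hqinj (hσM hsσ) hm h)
  obtain ⟨n, hn, g, hqn, hlcm, hle⟩ := hLQ m hm s (hσM hsσ) hqs
  have hg : g ∈ J := (hJ g).2 ⟨n, hn, hqn, hlcm⟩
  have hgN : nn g ∈ Nm := hNm ▸ Finset.mem_image_of_mem nn hg
  have hsm_ord : ord s < ord m := (hord₃ m hm s (hσM hsσ) hmN hsN).2 hqs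
  have hdvd : ∀ t, ord t ≤ ord s → nn g ≤ lcmV (topSeg ord σ t) := by
    intro t ht
    have hmem : ∀ a ∈ σ, ord t ≤ ord a → a ≤ lcmV (topSeg ord σ t) := fun a ha hta =>
      Finset.le_sup (f := id) (Finset.mem_filter.2 ⟨ha, hta⟩)
    calc nn g ≤ m ⊔ nn g := le_sup_right
      _ = m + Pi.single g 1 := (hnn g hg).2.2
      _ ≤ m ⊔ s := hle
      _ ≤ _ := sup_le (hmem m hmσ (ht.trans hsm_ord.le)) (hmem s hsσ ht)
  have hgood : GoodIdx M ord σ s :=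
    ⟨hsσ, nn g, (hnn g hg).1, hord₁ s (hσM hsσ) hsN _ hgN, hdvd s le_rfl⟩
  refine ⟨?_, ?_⟩
  · classical
    obtain ⟨t, ht, hmin⟩ := (σ.filter (GoodIdx M ord σ)).exists_min_image ord
      ⟨s, Finset.mem_filter.2 ⟨hsσ, hgood⟩⟩
    exact ⟨t, (Finset.mem_filter.1 ht).2, fun t' ht' =>
      hmin t' (Finset.mem_filter.2 ⟨ht'.1, ht'⟩)⟩
  · rintro μ ⟨t, ht, hμM, -, hμ⟩
    by_contra hμN
    exact absurd (hord₁ μ hμM hμN _ hgN)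
      (not_lt.2 (hμ _ (hnn g hg).1 (hdvd t (ht.2 s hgood))))
end
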